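/- The full subcategory of coherent sheaves of A-modules inside the abelian category of all sheaves of A-modules is an abelian subcategory: it is closed under finite direct sums, kernels, and cokernels. -/

import Mathlib

/-!
Finiteness conditions for sheaves of modules over a sheaf of rings on a
topological space `X`, following the paper. We use the Grothendieck topology
on `Opens X`; the restriction of a sheaf of modules to an open subset `U`
is given by `SheafOfModules.over`, and the further restriction of a sheaf of
`A|_U`-modules to a smaller open `V ≤ U` is given by pushforward to the
site `(J.over U).over V`.
-/

universe u

open CategoryTheory Limits TopologicalSpace

namespace CoherentSheaves

variable {X : TopCat.{u}} {R : Sheaf (Opens.grothendieckTopology X) RingCat.{u}}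

/-- The restriction of a sheaf of `A|_U`-modules to a smaller open `V ≤ U`. -/
noncomputable abbrev resOver {U : Opens X} (N : SheafOfModules.{u} (R.over U))
    {V : Opens X} (h : V ≤ U) :
    SheafOfModules.{u} ((R.over U).over (Over.mk (homOfLE h))) :=
  N.over (Over.mk (homOfLE h))

/-- The restriction of a morphism of sheaves of modules to an open subset `U`. -/
noncomputable abbrev resMap {M N : SheafOfModules.{u} R} (φ : M ⟶ N) (U : Opens X) :
    M.over U ⟶ N.over U :=
  (SheafOfModules.pushforward (𝟙 _)).map φ

/-- A sheaf of `A|_U`-modules `N` is locally finitely generated if every `x ∈ U` has an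
open neighborhood `V ≤ U` on which `N` admits an epimorphism from a finite free module. -/
def IsLFGOver {U : Opens X} (N : SheafOfModules.{u} (R.over U)) : Prop :=
  ∀ x ∈ U, ∃ (V : Opens X) (h : V ≤ U), x ∈ V ∧ ∃ n : ℕ, 0 < n ∧
    ∃ p : SheafOfModules.free (ULift.{u} (Fin n)) ⟶ resOver N h, Epi p

/-- A sheaf of `A|_U`-modules `N` is locally finitely presented if every `x ∈ U` has an
open neighborhood `V ≤ U` on which there is an exact sequence
`(A|_V)^{⊕m} ⟶ (A|_V)^{⊕n} ⟶ N|_V ⟶ 0`. -/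
def IsLFPOver {U : Opens X} (N : SheafOfModules.{u} (R.over U)) : Prop :=
  ∀ x ∈ U, ∃ (V : Opens X) (h : V ≤ U), x ∈ V ∧ ∃ m n : ℕ, 0 < m ∧ 0 < n ∧
    ∃ (f : (SheafOfModules.free (ULift.{u} (Fin m)) :
              SheafOfModules.{u} ((R.over U).over (Over.mk (homOfLE h)))) ⟶
             SheafOfModules.free (ULift.{u} (Fin n)))
      (p : SheafOfModules.free (ULift.{u} (Fin n)) ⟶ resOver N h)
      (w : f ≫ p = 0), Epi p ∧ (ShortComplex.mk f p w).Exact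

/-- A sheaf of `A`-modules `M` is locally finitely generated if every `x ∈ X` has an
open neighborhood `U` on which `M` admits an epimorphism from a finite free module. -/
def IsLFG (M : SheafOfModules.{u} R) : Prop :=
  ∀ x : X, ∃ U : Opens X, x ∈ U ∧ ∃ n : ℕ, 0 < n ∧
    ∃ p : SheafOfModules.free (ULift.{u} (Fin n)) ⟶ M.over U, Epi p

/-- A sheaf of `A`-modules `M` is locally finitely presented if every `x ∈ X` has an
open neighborhood `U` on which there is an exact sequence
`(A|_U)^{⊕m} ⟶ (A|_U)^{⊕n} ⟶ M|_U ⟶ 0`. -/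
def IsLFP (M : SheafOfModules.{u} R) : Prop :=
  ∀ x : X, ∃ U : Opens X, x ∈ U ∧ ∃ m n : ℕ, 0 < m ∧ 0 < n ∧
    ∃ (f : (SheafOfModules.free (ULift.{u} (Fin m)) :
              SheafOfModules.{u} (R.over U)) ⟶ SheafOfModules.free (ULift.{u} (Fin n)))
      (p : SheafOfModules.free (ULift.{u} (Fin n)) ⟶ M.over U)
      (w : f ≫ p = 0), Epi p ∧ (ShortComplex.mk f p w).Exact

/-- A sheaf of `A`-modules `M` is pseudo-coherent if for every open `U`, every locally
finitely generated `A|_U`-submodule of `M|_U` is locally finitely presented. -/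
def IsPseudoCoherent (M : SheafOfModules.{u} R) : Prop :=
  ∀ (U : Opens X) (N : SheafOfModules.{u} (R.over U)) (ι : N ⟶ M.over U),
    Mono ι → IsLFGOver N → IsLFPOver N

/-- A sheaf of `A`-modules is coherent if it is locally finitely generated
and pseudo-coherent. -/
def IsCoherent (M : SheafOfModules.{u} R) : Prop :=
  IsLFG M ∧ IsPseudoCoherent M

end CoherentSheaves

namespace CoherentSheaves

section Site

open Opposite

variable {C : Type u} [SmallCategory C] {J : GrothendieckTopology C} {R : Sheaf J RingCat.{u}}

/-- A property of arrows to `W` holds locally if it holds on a covering sieve of `W`. -/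
def Locally (J : GrothendieckTopology C) {W : C} (P : ∀ ⦃V : C⦄, (V ⟶ W) → Prop) : Prop :=
  ∃ S ∈ J W, ∀ ⦃V : C⦄ (h : V ⟶ W), S h → P h

namespace Locally

variable {W : C} {P Q : ∀ ⦃V : C⦄, (V ⟶ W) → Prop}

lemma mono (hP : Locally J P) (h : ∀ ⦃V : C⦄ (g : V ⟶ W), P g → Q g) : Locally J Q := by
  obtain ⟨S, hS, H⟩ := hP
  exact ⟨S, hS, fun V g hg => h g (H g hg)⟩

lemma and (hP : Locally J P) (hQ : Locally J Q) : Locally J fun V (g : V ⟶ W) => P g ∧ Q g := by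
  obtain ⟨S, hS, H⟩ := hP
  obtain ⟨T, hT, H'⟩ := hQ
  exact ⟨S ⊓ T, J.intersection_covering hS hT, fun V g hg => ⟨H g hg.1, H' g hg.2⟩⟩

lemma of_forall (h : ∀ ⦃V : C⦄ (g : V ⟶ W), P g) : Locally J P :=
  ⟨⊤, J.top_mem W, fun _ g _ => h g⟩

lemma pullback (hP : Locally J P) {W' : C} (g : W' ⟶ W) :
    Locally J fun V (h : V ⟶ W') => P (h ≫ g) := by
  obtain ⟨S, hS, H⟩ := hP
  exact ⟨S.pullback g, J.pullback_stable g hS, fun V h hh => H _ hh⟩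

lemma bind (hP : Locally J P)
    (h : ∀ ⦃V : C⦄ (g : V ⟶ W), P g → Locally J fun V' (g' : V' ⟶ V) => Q (g' ≫ g)) :
    Locally J Q := by
  obtain ⟨S, hS, H⟩ := hP
  choose T hT H' using fun ⦃V : C⦄ (g : V ⟶ W) (hg : S g) => h g (H g hg)
  refine ⟨Sieve.bind S T, J.bind_covering hS fun V g hg => hT g hg, ?_⟩
  rintro V _ ⟨V', g', g, hg, hg', rfl⟩
  exact H' g hg _ hg'

lemma forall_mem {ι : Type*} (s : Finset ι) {P : ι → ∀ ⦃V : C⦄, (V ⟶ W) → Prop}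
    (h : ∀ i, Locally J (P i)) : Locally J fun V (g : V ⟶ W) => ∀ i ∈ s, P i g := by
  classical
  induction s using Finset.induction_on with
  | empty => exact of_forall fun V g i hi => by simp at hi
  | insert a s _ ih => exact ((h a).and ih).mono fun V g hg => by simpa using hg

lemma forall_of_fintype {ι : Type*} [Fintype ι] {P : ι → ∀ ⦃V : C⦄, (V ⟶ W) → Prop}
    (h : ∀ i, Locally J (P i)) : Locally J fun V (g : V ⟶ W) => ∀ i, P i g :=
  (forall_mem Finset.univ h).mono fun _ _ hg i => hg i (Finset.mem_univ i)

end Locally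

/-- The ring of sections of `R` over `U`. -/
abbrev RingSec (R : Sheaf J RingCat.{u}) (U : C) : Type u := R.obj.obj (op U)

/-- The module of sections of `M` over `U`. -/
abbrev Sec (M : SheafOfModules.{u} R) (U : C) : Type u := M.val.obj (op U)

/-- Restriction of sections of the sheaf of rings. -/
def ringRes (R : Sheaf J RingCat.{u}) {U V : C} (g : V ⟶ U) : RingSec R U →+* RingSec R V :=
  (R.obj.map g.op).hom

/-- Restriction of sections of a sheaf of modules. -/
noncomputable def res (M : SheafOfModules.{u} R) {U V : C} (g : V ⟶ U) : Sec M U →+ Sec M V :=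
  (M.val.restrictₛₗ g.op).toAddMonoidHom

/-- The action of a morphism of sheaves of modules on sections. -/
def app {M N : SheafOfModules.{u} R} (f : M ⟶ N) (U : C) : Sec M U →ₗ[RingSec R U] Sec N U :=
  (f.val.app (op U)).hom

lemma res_smul (M : SheafOfModules.{u} R) {U V : C} (g : V ⟶ U) (a : RingSec R U) (t : Sec M U) :
    res M g (a • t) = ringRes R g a • res M g t :=
  M.val.map_smul g.op a t

lemma res_res (M : SheafOfModules.{u} R) {U V W : C} (g : V ⟶ U) (h : W ⟶ V) (t : Sec M U) :
    res M h (res M g t) = res M (h ≫ g) t :=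
  (M.val.map_comp_apply g.op h.op t).symm

lemma res_id (M : SheafOfModules.{u} R) {U : C} (t : Sec M U) : res M (𝟙 U) t = t := by
  change M.val.map (𝟙 _) t = t
  rw [M.val.map_id]
  rfl

lemma ringRes_ringRes {U V W : C} (g : V ⟶ U) (h : W ⟶ V) (t : RingSec R U) :
    ringRes R h (ringRes R g t) = ringRes R (h ≫ g) t := by
  simp [ringRes]

lemma app_res {M N : SheafOfModules.{u} R} (f : M ⟶ N) {U V : C} (g : V ⟶ U) (t : Sec M U) :
    app f V (res M g t) = res N g (app f U t) :=
  PresheafOfModules.naturality_apply f.val g.op t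

lemma app_comp {M N P : SheafOfModules.{u} R} (f : M ⟶ N) (g : N ⟶ P) (U : C) (t : Sec M U) :
    app (f ≫ g) U t = app g U (app f U t) := rfl

lemma app_id {M : SheafOfModules.{u} R} (U : C) (t : Sec M U) :
    app (𝟙 M) U t = t := rfl

lemma app_zero {M N : SheafOfModules.{u} R} (U : C) (t : Sec M U) :
    app (0 : M ⟶ N) U t = 0 := rfl

lemma app_add {M N : SheafOfModules.{u} R} (f g : M ⟶ N) (U : C) (t : Sec M U) :
    app (f + g) U t = app f U t + app g U t := rfl

lemma hom_ext_app {M N : SheafOfModules.{u} R} {f g : M ⟶ N} (h : ∀ U t, app f U t = app g U t) :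
    f = g := by
  ext U t
  exact h U.unop t

/-- Sections of a sheaf of modules that agree locally are equal. -/
lemma eq_of_locally_eq (M : SheafOfModules.{u} R) {U : C} {t t' : Sec M U} {S : Sieve U}
    (hS : S ∈ J U) (h : ∀ ⦃V : C⦄ (g : V ⟶ U), S g → res M g t = res M g t') : t = t' :=
  M.isSheaf.isSeparated _ _ hS _ _ h

lemma app_injective_of_mono {M N : SheafOfModules.{u} R} (f : M ⟶ N) [Mono f] (U : C) :
    Function.Injective (app f U) := by
  have : Mono ((SheafOfModules.evaluation R (op U)).map f) := inferInstance
  exact (ModuleCat.mono_iff_injective _).1 this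

lemma exists_app_eq_of_exact {S : ShortComplex (SheafOfModules.{u} R)} (hS : S.Exact) [Mono S.f]
    {U : C} {t : Sec S.X₂ U} (ht : app S.g U t = 0) : ∃ y, app S.f U y = t := by
  have : (SheafOfModules.evaluation R (op U)).PreservesZeroMorphisms := ⟨fun _ _ => rfl⟩
  have := hS.map_of_mono_of_preservesKernel (SheafOfModules.evaluation R (op U)) inferInstance
    inferInstance
  exact (ShortComplex.moduleCat_exact_iff _).1 this t ht

lemma epi_iff_locally_surjective {M N : SheafOfModules.{u} R} (f : M ⟶ N) :
    Epi f ↔ ∀ ⦃U : C⦄ (t : Sec N U), Locally J fun V (g : V ⟶ U) =>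
      ∃ y, app f V y = res N g t := by
  constructor
  · intro hf U t
    let q := cokernel.π f.val
    let adj := PresheafOfModules.sheafificationAdjunction (𝟙 R.obj)
    let η := adj.unit.app (cokernel f.val)
    have hη : Presheaf.IsLocallyInjective J ((PresheafOfModules.toPresheaf _).map η) := by
      rw [PresheafOfModules.toPresheaf_map_sheafificationAdjunction_unit_app]
      exact ((J.W_iff_isLocallyBijective _).1 (J.W_toSheafify _)).1
    let k : N ⟶ (PresheafOfModules.sheafification (𝟙 R.obj)).obj (cokernel f.val) :=
      ⟨q ≫ η⟩
    have hk : k = 0 := by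
      rw [← cancel_epi f]
      ext1
      change f.val ≫ q ≫ η = _
      rw [cokernel.condition_assoc]
      simp
      rfl
    have h0 : η.app (op U) (q.app (op U) t) = 0 := by
      exact congrArg (fun f => app f U t) hk
    refine ⟨_, Presheaf.equalizerSieve_mem J ((PresheafOfModules.toPresheaf _).map η)
      (X := op U) (q.app (op U) t) 0 (by rw [map_zero]; exact h0), ?_⟩
    intro V g hg
    have hq : q.app (op V) (res N g t) = 0 := by
      have : (cokernel f.val).map g.op (q.app (op U) t) = 0 := by
        refine Eq.trans (b := (cokernel f.val).map g.op 0) hg (map_zero _)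
      exact (PresheafOfModules.naturality_apply q g.op t).trans this
    have hE := (ShortComplex.exact_cokernel f.val).map
      (PresheafOfModules.evaluation R.obj (op V))
    exact (ShortComplex.moduleCat_exact_iff _).1 hE _ hq
  · intro h
    constructor
    intro P a b hab
    refine hom_ext_app fun U t => ?_
    obtain ⟨S, hS, H⟩ := h t
    refine eq_of_locally_eq P hS fun V g hg => ?_
    obtain ⟨y, hy⟩ := H g hg
    rw [← app_res, ← app_res, ← hy, ← app_comp, hab, app_comp]

section Free

variable {I : Type u}

/-- The sections over `W` of the standard basis of a free sheaf of modules. -/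
noncomputable def basisSec (R : Sheaf J RingCat.{u}) (W : C) (i : I) :
    Sec (SheafOfModules.free (R := R) I) W :=
  (SheafOfModules.freeSection (R := R) i).val (op W)

lemma res_basisSec {V W : C} (g : V ⟶ W) (i : I) :
    res _ g (basisSec R W i) = basisSec R V i :=
  PresheafOfModules.sections_property (SheafOfModules.freeSection (R := R) i) g.op

lemma app_basisSec {M : SheafOfModules.{u} R} (p : SheafOfModules.free I ⟶ M) (W : C) (i : I) :
    app p W (basisSec R W i) = (M.freeHomEquiv p i).val (op W) := rfl

/-- The morphism from a free sheaf of modules given by sections over a terminal object. -/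
noncomputable def freeDesc {T : C} (hT : IsTerminal T) {M : SheafOfModules.{u} R}
    (s : I → Sec M T) : SheafOfModules.free I ⟶ M :=
  M.freeHomEquiv.symm fun i => PresheafOfModules.sectionsMk
    (fun Y => res M (hT.from Y.unop) (s i)) fun Y Z g =>
      (res_res M (hT.from Y.unop) g.unop (s i)).trans (by rw [hT.hom_ext (g.unop ≫ _) _])

lemma app_freeDesc_basisSec {T : C} (hT : IsTerminal T) {M : SheafOfModules.{u} R}
    (s : I → Sec M T) (W : C) (i : I) :
    app (freeDesc hT s) W (basisSec R W i) = res M (hT.from W) (s i) := by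
  rw [app_basisSec, freeDesc, Equiv.apply_symm_apply]
  rfl

/-- The element of the unit sheaf of modules given by a section of the sheaf of rings. -/
def unitSec (R : Sheaf J RingCat.{u}) (W : C) (a : RingSec R W) :
    Sec (SheafOfModules.unit R) W := a

/-- The section of the sheaf of rings given by an element of the unit sheaf of modules. -/
def ofUnitSec {W : C} (a : Sec (SheafOfModules.unit R) W) : RingSec R W := a

lemma smul_unitSec_one {W : C} (a : Sec (SheafOfModules.unit R) W) :
    ofUnitSec a • unitSec R W 1 = a :=
  mul_one (ofUnitSec a)

lemma app_freeDesc_basisSec_self {T : C} (hT : IsTerminal T) {M : SheafOfModules.{u} R}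
    (s : I → Sec M T) (i : I) : app (freeDesc hT s) T (basisSec R T i) = s i := by
  rw [app_freeDesc_basisSec, hT.hom_ext (hT.from T) (𝟙 T), res_id]

lemma hom_ext_basisSec {T : C} (hT : IsTerminal T) {M : SheafOfModules.{u} R}
    {p q : SheafOfModules.free I ⟶ M}
    (h : ∀ i, app p T (basisSec R T i) = app q T (basisSec R T i)) : p = q := by
  refine M.freeHomEquiv.injective (funext fun i => PresheafOfModules.sections_ext _ _ fun W => ?_)
  have := congrArg (res M (hT.from W.unop)) (h i)
  rwa [← app_res, ← app_res, res_basisSec] at this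

lemma app_unit {M : SheafOfModules.{u} R} (f : SheafOfModules.unit R ⟶ M) (W : C)
    (a : Sec (SheafOfModules.unit R) W) : app f W a = ofUnitSec a • app f W (unitSec R W 1) := by
  rw [← map_smul, smul_unitSec_one]

/-- The coordinate functions on a free sheaf of modules. -/
noncomputable def coord (R : Sheaf J RingCat.{u}) (i : I) :
    SheafOfModules.free (R := R) I ⟶ SheafOfModules.unit R :=
  open Classical in
  (SheafOfModules.unit R).freeHomEquiv.symm fun k =>
    (SheafOfModules.unit R).unitHomEquiv (if k = i then 𝟙 _ else 0)

lemma ιFree_coord_self (i : I) : SheafOfModules.ιFree i ≫ coord R i = 𝟙 _ := by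
  rw [← SheafOfModules.unitHomEquiv_symm_freeHomEquiv_apply, coord]
  simp

lemma ιFree_coord_of_ne {i k : I} (h : k ≠ i) : SheafOfModules.ιFree k ≫ coord R i = 0 := by
  rw [← SheafOfModules.unitHomEquiv_symm_freeHomEquiv_apply, coord]
  simp [h]

variable [Fintype I]

lemma sum_coord_comp_ιFree :
    ∑ i : I, coord R i ≫ SheafOfModules.ιFree i = 𝟙 (SheafOfModules.free I) := by
  refine Cofan.IsColimit.hom_ext (SheafOfModules.isColimitFreeCofan I) _ _ fun k => ?_
  change SheafOfModules.ιFree k ≫ (∑ i : I, coord R i ≫ SheafOfModules.ιFree i) =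
    SheafOfModules.ιFree k ≫ 𝟙 (SheafOfModules.free I)
  rw [Preadditive.comp_sum, Finset.sum_eq_single k]
  · rw [← Category.assoc, ιFree_coord_self]
    simp
  · intro i _ hi
    rw [← Category.assoc, ιFree_coord_of_ne hi.symm, zero_comp]
  · simp

/-- Evaluation of a morphism on a section, as an additive map in the morphism. -/
noncomputable def appHom (M N : SheafOfModules.{u} R) (U : C) (t : Sec M U) :
    (M ⟶ N) →+ Sec N U where
  toFun f := app f U t
  map_zero' := rfl
  map_add' _ _ := rfl

lemma app_sum {M N : SheafOfModules.{u} R} {ι : Type*} (s : Finset ι) (f : ι → (M ⟶ N)) (U : C)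
    (t : Sec M U) : app (∑ i ∈ s, f i) U t = ∑ i ∈ s, app (f i) U t :=
  map_sum (appHom M N U t) f s

lemma exists_eq_sum_basisSec {W : C} (t : Sec (SheafOfModules.free (R := R) I) W) :
    ∃ a : I → RingSec R W, t = ∑ i, a i • basisSec R W i := by
  refine ⟨fun i => ofUnitSec (app (coord R i) W t), ?_⟩
  conv_lhs => rw [← app_id W t, ← sum_coord_comp_ιFree, app_sum]
  refine Finset.sum_congr rfl fun i _ => ?_
  rw [app_comp, app_unit]
  rfl

lemma app_coord_sum {W : C} (a : I → RingSec R W) (i : I) :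
    app (coord R i) W (∑ k, a k • basisSec R W k) = unitSec R W (a i) := by
  have h (k : I) : app (coord R i) W (basisSec R W k) =
      app (SheafOfModules.ιFree k ≫ coord R i) W (unitSec R W 1) := rfl
  rw [map_sum, Finset.sum_eq_single i]
  · rw [map_smul, h, ιFree_coord_self, app_id]
    exact mul_one (a i)
  · intro k _ hk
    rw [map_smul, h, ιFree_coord_of_ne hk, app_zero, smul_zero]
  · simp

lemma sum_basisSec_injective {W : C} {a b : I → RingSec R W}
    (h : ∑ i, a i • basisSec R W i = ∑ i, b i • basisSec R W i) : a = b := by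
  ext i
  have := app_coord_sum a i
  rw [h, app_coord_sum] at this
  exact this.symm

end Free

section Generators

variable {I K : Type u} [Fintype I] [Fintype K]

/-- A finite family of sections over `U` generates `M` over `U` if every section over an object
above `U` is locally a linear combination of the family. -/
def IsGen (M : SheafOfModules.{u} R) {U : C} (s : I → Sec M U) : Prop :=
  ∀ ⦃W : C⦄ (g : W ⟶ U) (t : Sec M W), Locally J fun V (h : V ⟶ W) =>
    ∃ a : I → RingSec R V, res M h t = ∑ i, a i • res M (h ≫ g) (s i)

/-- A finite family of relations between sections `s` over `U` is complete if every relation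
between the restrictions of `s` is locally a linear combination of the family. -/
def IsRel (M : SheafOfModules.{u} R) {U : C} (s : I → Sec M U) (r : K → I → RingSec R U) : Prop :=
  (∀ k, ∑ i, r k i • s i = 0) ∧
  ∀ ⦃W : C⦄ (g : W ⟶ U) (a : I → RingSec R W), ∑ i, a i • res M g (s i) = 0 →
    Locally J fun V (h : V ⟶ W) =>
      ∃ c : K → RingSec R V, ∀ i, ringRes R h (a i) = ∑ k, c k * ringRes R (h ≫ g) (r k i)

lemma res_sum_smul (M : SheafOfModules.{u} R) {U V : C} (g : V ⟶ U) (a : I → RingSec R U)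
    (s : I → Sec M U) :
    res M g (∑ i, a i • s i) = ∑ i, ringRes R g (a i) • res M g (s i) := by
  simp_rw [map_sum, res_smul]

lemma app_sum_basisSec {M : SheafOfModules.{u} R} {T : C} (hT : IsTerminal T)
    (p : SheafOfModules.free I ⟶ M) {W : C} (a : I → RingSec R W) :
    app p W (∑ i, a i • basisSec R W i) =
      ∑ i, a i • res M (hT.from W) (app p T (basisSec R T i)) := by
  simp_rw [map_sum, map_smul, ← app_res, res_basisSec]

lemma epi_iff_isGen {M : SheafOfModules.{u} R} {T : C} (hT : IsTerminal T)
    (p : SheafOfModules.free I ⟶ M) :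
    Epi p ↔ IsGen M fun i => app p T (basisSec R T i) := by
  rw [epi_iff_locally_surjective]
  constructor
  · intro H W g t
    obtain ⟨S, hS, h⟩ := H t
    refine ⟨S, hS, fun V g hg => ?_⟩
    obtain ⟨y, hy⟩ := h g hg
    obtain ⟨a, rfl⟩ := exists_eq_sum_basisSec y
    refine ⟨a, ?_⟩
    rw [← hy, app_sum_basisSec hT, hT.hom_ext (g ≫ _) (hT.from V)]
  · intro H W t
    obtain ⟨S, hS, h⟩ := H (hT.from W) t
    refine ⟨S, hS, fun V g hg => ?_⟩
    obtain ⟨a, ha⟩ := h g hg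
    exact ⟨_, by rw [ha, hT.hom_ext (g ≫ _) (hT.from V)]; exact app_sum_basisSec hT p a⟩

lemma exact_iff_locally_exact (S : ShortComplex (SheafOfModules.{u} R)) :
    S.Exact ↔ ∀ ⦃U : C⦄ (t : Sec S.X₂ U), app S.g U t = 0 →
      Locally J fun V (g : V ⟶ U) => ∃ y, app S.f V y = res S.X₂ g t := by
  rw [S.exact_iff_epi_kernel_lift, epi_iff_locally_surjective]
  have hι {V : C} (y : Sec S.X₁ V) :
      app (kernel.ι S.g) V (app (kernel.lift S.g S.f S.zero) V y) = app S.f V y := by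
    rw [← app_comp, kernel.lift_ι]
  constructor
  · intro H U t ht
    obtain ⟨t, rfl⟩ := exists_app_eq_of_exact (ShortComplex.exact_kernel S.g) ht
    obtain ⟨T, hT, h⟩ := H t
    refine ⟨T, hT, fun V g hg => ?_⟩
    obtain ⟨y, hy⟩ := h g hg
    refine ⟨y, ?_⟩
    rw [← hι, hy]
    exact app_res _ _ _
  · intro H U t
    have h0 : app S.g U (app (kernel.ι S.g) U t) = 0 := by
      rw [← app_comp, kernel.condition, app_zero]
    obtain ⟨T, hT, h⟩ := H _ h0
    refine ⟨T, hT, fun V g hg => ?_⟩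
    obtain ⟨y, hy⟩ := h g hg
    refine ⟨y, app_injective_of_mono (kernel.ι S.g) V ?_⟩
    rw [hι, hy, app_res]

lemma exact_iff_isRel {M : SheafOfModules.{u} R} {T : C} (hT : IsTerminal T)
    (f : SheafOfModules.free K ⟶ SheafOfModules.free I) (p : SheafOfModules.free I ⟶ M)
    (w : f ≫ p = 0) (r : K → I → RingSec R T)
    (hr : ∀ k, app f T (basisSec R T k) = ∑ i, r k i • basisSec R T i) :
    (ShortComplex.mk f p w).Exact ↔ IsRel M (fun i => app p T (basisSec R T i)) r := by
  rw [exact_iff_locally_exact]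
  have hf {W : C} (g : W ⟶ T) (c : K → RingSec R W) : app f W (∑ k, c k • basisSec R W k) =
      ∑ i, (∑ k, c k * ringRes R g (r k i)) • basisSec R W i := by
    rw [app_sum_basisSec hT, hT.hom_ext (hT.from W) g]
    simp_rw [hr, res_sum_smul, res_basisSec, Finset.smul_sum, Finset.sum_smul, mul_smul]
    exact Finset.sum_comm
  constructor
  · intro H
    refine ⟨fun k => ?_, fun W g a ha => ?_⟩
    · simp_rw [← map_smul, ← map_sum, ← hr, ← app_comp, w, app_zero]
    · obtain ⟨S, hS, h⟩ := H (∑ i, a i • basisSec R W i) (by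
        rw [← ha, hT.hom_ext g (hT.from W)]
        exact app_sum_basisSec hT p a)
      refine ⟨S, hS, fun V g' hg => ?_⟩
      obtain ⟨y, hy⟩ := h g' hg
      obtain ⟨c, rfl⟩ := exists_eq_sum_basisSec y
      refine ⟨c, fun i => ?_⟩
      simp only [hf (g' ≫ g), res_sum_smul, res_basisSec] at hy
      exact (congrFun (sum_basisSec_injective hy) i).symm
  · intro H W t ht
    obtain ⟨a, rfl⟩ := exists_eq_sum_basisSec t
    obtain ⟨S, hS, h⟩ := H.2 (hT.from W) a ((app_sum_basisSec hT p a).symm.trans ht)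
    refine ⟨S, hS, fun V g hg => ?_⟩
    obtain ⟨c, hc⟩ := h g hg
    refine ⟨∑ k, c k • basisSec R V k, ?_⟩
    simp only [hf (g ≫ hT.from W), res_sum_smul, res_basisSec, hc]

/-- A property holds locally over an object of `Over U` iff it holds locally in the base site. -/
lemma locally_over_iff {U : C} {Y : Over U} (P : ∀ ⦃V : C⦄, (V ⟶ Y.left) → Prop) :
    (Locally (J.over U) fun Z (h : Z ⟶ Y) => P h.left) ↔ Locally J P := by
  constructor
  · rintro ⟨S, hS, H⟩
    refine ⟨Sieve.overEquiv Y S, (J.mem_over_iff S).1 hS, fun V h hh => ?_⟩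
    exact H _ ((Sieve.overEquiv_iff S h).1 hh)
  · rintro ⟨S, hS, H⟩
    refine ⟨(Sieve.overEquiv Y).symm S, J.overEquiv_symm_mem_over _ _ hS, fun Z h hh => ?_⟩
    exact H _ ((Sieve.overEquiv_symm_iff S h).1 hh)

lemma isGen_over_iff (M : SheafOfModules.{u} R) {U : C} (Y : Over U) (s : I → Sec M Y.left) :
    IsGen (M.over U) (U := Y) s ↔ IsGen M s := by
  have key {Z : Over U} (g : Z ⟶ Y) (t : Sec M Z.left) :=
    locally_over_iff (J := J) (Y := Z) fun V h =>
      ∃ a : I → RingSec R V, res M h t = ∑ i, a i • res M (h ≫ g.left) (s i)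
  constructor
  · intro H W g t
    exact (key (Over.homMk (U := Over.mk (g ≫ Y.hom)) g) t).1
      (H (W := Over.mk (g ≫ Y.hom)) (Over.homMk g) t)
  · intro H Z g t
    exact (key g t).2 (H g.left t)

lemma isRel_over_iff (M : SheafOfModules.{u} R) {U : C} (Y : Over U) (s : I → Sec M Y.left)
    (r : K → I → RingSec R Y.left) :
    IsRel (M.over U) (U := Y) s r ↔ IsRel M s r := by
  have key {Z : Over U} (g : Z ⟶ Y) (a : I → RingSec R Z.left) :=
    locally_over_iff (J := J) (Y := Z) fun V h =>
      ∃ c : K → RingSec R V, ∀ i, ringRes R h (a i) = ∑ k, c k * ringRes R (h ≫ g.left) (r k i)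
  constructor
  · refine fun H => ⟨H.1, fun W g a ha => ?_⟩
    exact (key (Over.homMk (U := Over.mk (g ≫ Y.hom)) g) a).1
      (H.2 (W := Over.mk (g ≫ Y.hom)) (Over.homMk g) a ha)
  · refine fun H => ⟨H.1, fun Z g a ha => ?_⟩
    exact (key g a).2 (H.2 g.left a ha)

lemma exists_epi_iff {T : C} (hT : IsTerminal T) (M : SheafOfModules.{u} R) :
    (∃ p : SheafOfModules.free I ⟶ M, Epi p) ↔ ∃ s : I → Sec M T, IsGen M s := by
  constructor
  · rintro ⟨p, hp⟩
    exact ⟨_, (epi_iff_isGen hT p).1 hp⟩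
  · rintro ⟨s, hs⟩
    refine ⟨freeDesc hT s, (epi_iff_isGen hT _).2 ?_⟩
    simpa only [app_freeDesc_basisSec_self] using hs

lemma exists_presentation_iff {T : C} (hT : IsTerminal T) (M : SheafOfModules.{u} R) :
    (∃ (f : (SheafOfModules.free K : SheafOfModules.{u} R) ⟶ SheafOfModules.free I)
      (p : SheafOfModules.free I ⟶ M) (w : f ≫ p = 0),
        Epi p ∧ (ShortComplex.mk f p w).Exact) ↔
      ∃ (s : I → Sec M T) (r : K → I → RingSec R T), IsGen M s ∧ IsRel M s r := by
  constructor
  · rintro ⟨f, p, w, hp, hf⟩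
    choose r hr using fun k => exists_eq_sum_basisSec (app f T (basisSec R T k))
    exact ⟨_, r, (epi_iff_isGen hT p).1 hp, (exact_iff_isRel hT f p w r hr).1 hf⟩
  · rintro ⟨s, r, hs, hr⟩
    have hp (i : I) := app_freeDesc_basisSec_self hT s i
    have hf (k : K) := app_freeDesc_basisSec_self hT (fun k => ∑ i, r k i • basisSec R T i) k
    have w : freeDesc hT (fun k => ∑ i, r k i • basisSec R T i) ≫ freeDesc hT s = 0 := by
      refine hom_ext_basisSec hT fun k => ?_
      rw [app_comp, hf, map_sum, app_zero, ← hr.1 k]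
      simp_rw [map_smul, hp]
    refine ⟨_, _, w, (epi_iff_isGen hT _).2 ?_, (exact_iff_isRel hT _ _ w r hf).2 ?_⟩
    · simpa only [hp] using hs
    · simpa only [hp] using hr

lemma exists_epi_over_iff (M : SheafOfModules.{u} R) (U : C) :
    (∃ p : SheafOfModules.free I ⟶ M.over U, Epi p) ↔ ∃ s : I → Sec M U, IsGen M s :=
  (exists_epi_iff Over.mkIdTerminal (M.over U)).trans
    (exists_congr fun s => isGen_over_iff M (Over.mk (𝟙 U)) s)

lemma exists_presentation_over_iff (M : SheafOfModules.{u} R) (U : C) :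
    (∃ (f : (SheafOfModules.free K : SheafOfModules.{u} (R.over U)) ⟶ SheafOfModules.free I)
      (p : SheafOfModules.free I ⟶ M.over U) (w : f ≫ p = 0),
        Epi p ∧ (ShortComplex.mk f p w).Exact) ↔
      ∃ (s : I → Sec M U) (r : K → I → RingSec R U), IsGen M s ∧ IsRel M s r :=
  (exists_presentation_iff Over.mkIdTerminal (M.over U)).trans
    (exists_congr fun s => exists_congr fun r =>
      and_congr (isGen_over_iff M (Over.mk (𝟙 U)) s) (isRel_over_iff M (Over.mk (𝟙 U)) s r))

end Generators

section Elementary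

lemma sum_smul_sum_smul {A E I K : Type*} [Ring A] [AddCommGroup E] [Module A E] [Fintype I]
    [Fintype K] (c : K → A) (r : K → I → A) (s : I → E) :
    ∑ k, c k • ∑ i, r k i • s i = ∑ i, (∑ k, c k * r k i) • s i := by
  simp_rw [Finset.smul_sum, Finset.sum_smul, mul_smul]
  exact Finset.sum_comm

variable {I K L : Type u} [Fintype I] [Fintype K] [Fintype L]

lemma IsGen.res {M : SheafOfModules.{u} R} {U V : C} {s : I → Sec M U} (hs : IsGen M s)
    (g : V ⟶ U) : IsGen M fun i => res M g (s i) := by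
  intro W h t
  refine (hs (h ≫ g) t).mono fun V' h' ⟨a, ha⟩ => ⟨a, ?_⟩
  simpa only [res_res, Category.assoc] using ha

lemma IsRel.res {M : SheafOfModules.{u} R} {U V : C} {s : I → Sec M U} {r : K → I → RingSec R U}
    (hr : IsRel M s r) (g : V ⟶ U) :
    IsRel M (fun i => res M g (s i)) fun k i => ringRes R g (r k i) := by
  refine ⟨fun k => ?_, fun W h a ha => ?_⟩
  · rw [← res_sum_smul, hr.1, map_zero]
  · simp only [res_res] at ha
    refine (hr.2 (h ≫ g) a ha).mono fun V' h' ⟨c, hc⟩ => ⟨c, fun i => ?_⟩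
    simpa only [ringRes_ringRes, Category.assoc] using hc i

/-- `M` is generated by finitely many sections over `U`. -/
def FinGen (M : SheafOfModules.{u} R) (U : C) : Prop :=
  ∃ (I : Type u) (_ : Fintype I) (s : I → Sec M U), IsGen M s

/-- The sheaf of relations between the sections `s` over `U` is generated by finitely many
relations. -/
def FinRel (M : SheafOfModules.{u} R) {U : C} (s : I → Sec M U) : Prop :=
  ∃ (K : Type u) (_ : Fintype K) (r : K → I → RingSec R U), IsRel M s r

lemma FinGen.res {M : SheafOfModules.{u} R} {U V : C} (h : FinGen M U) (g : V ⟶ U) :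
    FinGen M V := by
  obtain ⟨I, _, s, hs⟩ := h
  exact ⟨I, inferInstance, _, hs.res g⟩

lemma FinRel.res {M : SheafOfModules.{u} R} {U V : C} {s : I → Sec M U} (h : FinRel M s)
    (g : V ⟶ U) : FinRel M fun i => res M g (s i) := by
  obtain ⟨K, _, r, hr⟩ := h
  exact ⟨K, inferInstance, _, hr.res g⟩

/-- Over every object, `M` is locally generated by finitely many sections. -/
def LocallyFinGen (M : SheafOfModules.{u} R) : Prop :=
  ∀ U : C, Locally J fun V (_ : V ⟶ U) => FinGen M V

/-- The relations between finitely many sections of `M` are locally finitely generated. -/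
def LocallyFinRel (M : SheafOfModules.{u} R) : Prop :=
  ∀ (U : C) (I : Type u) [Fintype I] (s : I → Sec M U),
    Locally J fun V (g : V ⟶ U) => FinRel M fun i => res M g (s i)

lemma isRel_app_iff {M N : SheafOfModules.{u} R} (f : M ⟶ N) [Mono f] {U : C} (s : I → Sec M U)
    (r : K → I → RingSec R U) : IsRel N (fun i => app f U (s i)) r ↔ IsRel M s r := by
  have key {W : C} (a : I → RingSec R W) (t : I → Sec M W) :
      ∑ i, a i • app f W (t i) = 0 ↔ ∑ i, a i • t i = 0 := by
    simp_rw [← map_smul, ← map_sum]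
    exact map_eq_zero_iff _ (app_injective_of_mono f W)
  simp only [IsRel, ← app_res, key]

/-- Completeness of a composite family of relations, for a jointly injective pair of maps. -/
lemma IsRel.comp {M N P : SheafOfModules.{u} R} (f : P ⟶ M) (g : P ⟶ N)
    (hfg : ∀ (W : C) (t : Sec P W), app f W t = 0 → app g W t = 0 → t = 0)
    {U : C} {s : I → Sec P U} {r : K → I → RingSec R U} {q : L → K → RingSec R U}
    (hr : IsRel M (fun i => app f U (s i)) r)
    (hq : IsRel N (fun k => ∑ i, r k i • app g U (s i)) q) :
    IsRel P s fun l i => ∑ k, q l k * r k i := by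
  refine ⟨fun l => hfg _ _ ?_ ?_, fun W h a ha => ?_⟩
  · simp_rw [map_sum, map_smul, ← sum_smul_sum_smul, hr.1, smul_zero, Finset.sum_const_zero]
  · simp_rw [map_sum, map_smul, ← sum_smul_sum_smul, hq.1]
  · have haf := congrArg (app f W) ha
    have hag := congrArg (app g W) ha
    simp_rw [map_sum, map_smul, map_zero, app_res] at haf hag
    refine (hr.2 h a haf).bind fun V h' ⟨c, hc⟩ => ?_
    have hcN : ∑ k, c k • CoherentSheaves.res N (h' ≫ h) (∑ i, r k i • app g U (s i)) = 0 := by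
      simp_rw [res_sum_smul, sum_smul_sum_smul, ← hc, ← res_res, ← res_sum_smul, hag, map_zero]
    refine (hq.2 (h' ≫ h) c hcN).mono fun V' h'' ⟨d, hd⟩ => ⟨d, fun i => ?_⟩
    rw [← ringRes_ringRes, hc, map_sum]
    simp_rw [map_mul, map_sum, hd, ringRes_ringRes, Finset.sum_mul, Finset.mul_sum, map_mul,
      mul_assoc, Category.assoc]
    exact Finset.sum_comm

/-- Finite generation of relations only depends on the submodule generated by the sections. -/
lemma FinRel.of_generated {M : SheafOfModules.{u} R} {U : C} {s : I → Sec M U} {e : L → Sec M U}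
    (he : FinRel M e) (hse : ∀ i, ∃ a : L → RingSec R U, s i = ∑ l, a l • e l)
    (hes : ∀ l, ∃ b : I → RingSec R U, e l = ∑ i, b i • s i) : FinRel M s := by
  classical
  obtain ⟨K, _, r, hr⟩ := he
  choose a ha using hse
  choose b hb using hes
  refine ⟨I ⊕ K, inferInstance, Sum.elim
    (fun j i => (if j = i then 1 else 0) - ∑ l, a j l * b l i) (fun k i => ∑ l, r k l * b l i),
    ?_, fun W g c hc => ?_⟩
  · rintro (j | k)
    · simp_rw [Sum.elim_inl, sub_smul, Finset.sum_sub_distrib, ← sum_smul_sum_smul, ← hb, ← ha]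
      simp
    · simp_rw [Sum.elim_inr, ← sum_smul_sum_smul, ← hb, hr.1]
  · have hce : ∑ l, (∑ i, c i * ringRes R g (a i l)) • CoherentSheaves.res M g (e l) = 0 := by
      rw [← hc, ← sum_smul_sum_smul]
      simp_rw [← res_sum_smul, ← ha]
    refine (hr.2 g _ hce).mono fun V h ⟨d, hd⟩ =>
      ⟨Sum.elim (fun i => ringRes R h (c i)) d, fun i => ?_⟩
    have : ∑ l, (∑ j, ringRes R h (c j) * ringRes R (h ≫ g) (a j l)) * ringRes R (h ≫ g) (b l i) =
        ∑ l, (∑ k, d k * ringRes R (h ≫ g) (r k l)) * ringRes R (h ≫ g) (b l i) := by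
      simp_rw [← hd, map_sum, map_mul, ringRes_ringRes]
    simp_rw [Finset.sum_mul, mul_assoc] at this
    rw [Finset.sum_comm] at this
    rw [Finset.sum_comm (s := Finset.univ (α := L))] at this
    simp_rw [Fintype.sum_sum_type, Sum.elim_inl, Sum.elim_inr, map_sub, mul_sub, map_sum, map_mul,
      Finset.sum_sub_distrib, Finset.mul_sum, this]
    simp

lemma LocallyFinRel.of_mono {M N : SheafOfModules.{u} R} (f : M ⟶ N) [Mono f]
    (hN : LocallyFinRel N) : LocallyFinRel M := by
  intro U I _ s
  refine (hN U I fun i => app f U (s i)).mono fun V g ⟨K, _, r, hr⟩ => ⟨K, inferInstance, r, ?_⟩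
  simp_rw [← app_res] at hr
  exact (isRel_app_iff f _ r).1 hr

end Elementary

section Closure

variable {M N : SheafOfModules.{u} R}

lemma biprod_section_eq {U : C} (t : Sec (M ⊞ N) U) :
    t = app biprod.inl U (app biprod.fst U t) + app biprod.inr U (app biprod.snd U t) := by
  conv_lhs => rw [← app_id U t, ← biprod.total, app_add]
  rfl

lemma LocallyFinGen.biprod (hM : LocallyFinGen M) (hN : LocallyFinGen N) :
    LocallyFinGen (M ⊞ N) := by
  intro U
  refine ((hM U).and (hN U)).mono fun V _ ⟨⟨I, _, s, hs⟩, ⟨K, _, t, ht⟩⟩ =>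
    ⟨I ⊕ K, inferInstance, Sum.elim (fun i => app biprod.inl V (s i))
      fun k => app biprod.inr V (t k), fun W g u => ?_⟩
  refine ((hs g (app biprod.fst W u)).and (ht g (app biprod.snd W u))).mono
    fun V' h ⟨⟨a, ha⟩, ⟨b, hb⟩⟩ => ⟨Sum.elim a b, ?_⟩
  rw [biprod_section_eq (res (M ⊞ N) h u), app_res biprod.fst, app_res biprod.snd, ha, hb]
  simp_rw [map_sum, map_smul, Fintype.sum_sum_type, Sum.elim_inl, Sum.elim_inr, app_res]

lemma LocallyFinRel.biprod (hM : LocallyFinRel M) (hN : LocallyFinRel N) :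
    LocallyFinRel (M ⊞ N) := by
  intro U I _ s
  refine (hM U I fun i => app biprod.fst U (s i)).bind fun V g ⟨K, _, r, hr⟩ => ?_
  refine (hN V K fun k => ∑ i, r k i • app biprod.snd V (res _ g (s i))).mono
    fun V' h ⟨L, _, q, hq⟩ => ⟨L, inferInstance, _,
      IsRel.comp (biprod.fst : M ⊞ N ⟶ M) biprod.snd (fun W t h₁ h₂ => ?_)
        (r := fun k i => ringRes R h (r k i)) (q := q) ?_ ?_⟩
  · rw [biprod_section_eq t, h₁, h₂, map_zero, map_zero, add_zero]
  · have := hr.res h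
    simp_rw [← app_res, res_res] at this
    exact this
  · simp_rw [res_sum_smul, ← app_res, res_res] at hq
    exact hq

lemma LocallyFinGen.kernel (φ : M ⟶ N) (hM : LocallyFinGen M) (hN : LocallyFinRel N) :
    LocallyFinGen (kernel φ) := by
  intro U
  refine (hM U).bind fun V _ ⟨I, _, s, hs⟩ => ?_
  refine (hN V I fun i => app φ V (s i)).mono fun V' g ⟨K, _, r, hr⟩ => ?_
  simp_rw [← app_res] at hr
  have hx (k : K) : ∃ y, app (kernel.ι φ) V' y = ∑ i, r k i • res M g (s i) :=
    exists_app_eq_of_exact (ShortComplex.exact_kernel φ) (by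
      change app φ V' _ = 0
      simp_rw [map_sum, map_smul, hr.1])
  choose y hy using hx
  refine ⟨K, inferInstance, y, fun W h t => ?_⟩
  refine (hs.res g h (app (kernel.ι φ) W t)).bind fun Z h' ⟨a, ha⟩ => ?_
  have hφ : ∑ i, a i • res N (h' ≫ h) (app φ V' (res M g (s i))) = 0 := by
    simp_rw [← app_res, ← map_smul, ← map_sum, ← ha, app_res, ← app_comp, kernel.condition,
      app_zero, map_zero]
  refine (hr.2 _ a hφ).mono fun Z' h'' ⟨c, hc⟩ => ⟨c, app_injective_of_mono (kernel.ι φ) Z' ?_⟩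
  rw [← res_res, app_res, app_res, ha, res_sum_smul]
  simp_rw [map_sum, map_smul, app_res, hy, res_sum_smul, sum_smul_sum_smul, hc, res_res,
    Category.assoc]

lemma cokernel_locally_lift (φ : M ⟶ N) {U : C} (t : Sec (cokernel φ) U) :
    Locally J fun V (g : V ⟶ U) => ∃ y, app (cokernel.π φ) V y = res _ g t :=
  (epi_iff_locally_surjective _).1 inferInstance t

lemma LocallyFinGen.cokernel (φ : M ⟶ N) (hN : LocallyFinGen N) :
    LocallyFinGen (cokernel φ) := by
  intro U
  refine (hN U).mono fun V _ ⟨I, _, s, hs⟩ =>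
    ⟨I, inferInstance, fun i => app (cokernel.π φ) V (s i), fun W g t => ?_⟩
  refine (cokernel_locally_lift φ t).bind fun V' h ⟨y, hy⟩ => ?_
  refine (hs (h ≫ g) y).mono fun Z h' ⟨a, ha⟩ => ⟨a, ?_⟩
  rw [← res_res, ← hy, ← app_res, ha]
  simp_rw [map_sum, map_smul, app_res, Category.assoc]

lemma LocallyFinRel.cokernel (φ : M ⟶ N) (hM : LocallyFinGen M) (hN : LocallyFinRel N) :
    LocallyFinRel (cokernel φ) := by
  intro U I _ s
  refine (Locally.forall_of_fintype fun i => cokernel_locally_lift φ (s i)).bind fun V g hy => ?_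
  choose y hy using hy
  refine (hM V).bind fun V' g' ⟨L, _, m, hm⟩ => ?_
  refine (hN V' (I ⊕ L) (Sum.elim (fun i => res N g' (y i)) fun l => app φ V' (m l))).mono
    fun Z h ⟨K, _, r, hr⟩ => ⟨K, inferInstance, fun k i => r k (Sum.inl i), ?_⟩
  have hs : (fun i => res _ ((h ≫ g') ≫ g) (s i)) =
      fun i => app (cokernel.π φ) Z (res N h (res N g' (y i))) := by
    simp_rw [app_res, hy, res_res, Category.assoc]
  have hπφ {W : C} (t : Sec M W) : app (cokernel.π φ) W (app φ W t) = 0 := by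
    rw [← app_comp, cokernel.condition, app_zero]
  rw [hs]
  refine ⟨fun k => ?_, fun W p a ha => ?_⟩
  · have := congrArg (app (cokernel.π φ) Z) (hr.1 k)
    simpa [Fintype.sum_sum_type, app_res, hπφ] using this
  · simp_rw [← app_res, ← map_smul, ← map_sum] at ha
    refine ((exact_iff_locally_exact _).1 (ShortComplex.exact_cokernel φ) _ ha).bind
      fun W' q ⟨z, hz⟩ => ?_
    refine (hm ((q ≫ p) ≫ h) z).bind fun W'' q' ⟨b, hb⟩ => ?_
    refine (hr.2 (q' ≫ q ≫ p)
      (Sum.elim (fun i => ringRes R (q' ≫ q) (a i)) fun l => - b l) ?_).mono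
      fun _ v ⟨c, hc⟩ => ⟨c, fun i => ?_⟩
    · have hφ := congrArg (app φ W'') hb
      have hz' : app φ W' z = res N q (∑ i, a i • res N p (res N h (res N g' (y i)))) := hz
      rw [app_res, hz'] at hφ
      simp only [map_sum, res_smul, res_res, map_smul, app_res, ringRes_ringRes,
        Category.assoc] at hφ
      simp only [Fintype.sum_sum_type, Sum.elim_inl, Sum.elim_inr, neg_smul,
        Finset.sum_neg_distrib, res_res, Category.assoc]
      rw [hφ, add_neg_cancel]
    · have := hc (Sum.inl i)
      simpa [ringRes_ringRes] using this

end Closure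

section Padding

variable {M : SheafOfModules.{u} R} {U : C} {I I' K K' : Type u}
  [Fintype I] [Fintype I'] [Fintype K] [Fintype K']

lemma IsGen.comp_equiv {s : I → Sec M U} (hs : IsGen M s) (e : I' ≃ I) : IsGen M (s ∘ e) :=
  fun _ g t => (hs g t).mono fun _ h ⟨a, ha⟩ =>
    ⟨a ∘ e, ha.trans (e.sum_comp fun i => a i • CoherentSheaves.res M (h ≫ g) (s i)).symm⟩

lemma IsRel.comp_equiv {s : I → Sec M U} {r : K → I → RingSec R U} (hr : IsRel M s r)
    (e : I' ≃ I) (e' : K' ≃ K) : IsRel M (s ∘ e) fun k i => r (e' k) (e i) := by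
  refine ⟨fun k => ?_, fun W g a ha => ?_⟩
  · exact (e.sum_comp fun i => r (e' k) i • s i).trans (hr.1 _)
  · refine (hr.2 g (a ∘ e.symm) ?_).mono fun V h ⟨c, hc⟩ => ⟨c ∘ e', fun i => ?_⟩
    · rw [← ha, ← e.sum_comp]
      simp
    · rw [← e.symm_apply_apply i]
      refine (hc (e i)).trans ?_
      rw [← e'.sum_comp]
      simp

lemma IsGen.option {s : I → Sec M U} (hs : IsGen M s) :
    IsGen M fun i : Option I => i.elim 0 s :=
  fun _ g t => (hs g t).mono fun _ h ⟨a, ha⟩ => ⟨fun i => i.elim 0 a, by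
    simpa [Fintype.sum_option] using ha⟩

lemma IsRel.option {s : I → Sec M U} {r : K → I → RingSec R U} (hr : IsRel M s r) :
    IsRel M (fun i : Option I => i.elim 0 s)
      fun (k : Option K) (i : Option I) => k.elim (i.elim 1 0) fun k => i.elim 0 (r k) := by
  refine ⟨fun k => ?_, fun W g a ha => ?_⟩
  · cases k with
    | none => simp [Fintype.sum_option]
    | some k => simpa [Fintype.sum_option] using hr.1 k
  · refine (hr.2 g (a ∘ some) (by simpa [Fintype.sum_option] using ha)).mono
      fun V h ⟨c, hc⟩ => ⟨fun k => k.elim (ringRes R h (a none)) c, fun i => ?_⟩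
    cases i with
    | none => simp [Fintype.sum_option]
    | some i => simpa [Fintype.sum_option] using hc i

/-- An enumeration of `Option I` by a nonempty initial segment of the natural numbers. -/
noncomputable def optionEquiv (I : Type u) [Fintype I] :
    ULift.{u} (Fin (Fintype.card I + 1)) ≃ Option I :=
  Equiv.ulift.trans (Fintype.equivFinOfCardEq Fintype.card_option).symm

lemma finGen_iff : FinGen M U ↔ ∃ n : ℕ, 0 < n ∧
    ∃ p : SheafOfModules.free (ULift.{u} (Fin n)) ⟶ M.over U, Epi p := by
  simp_rw [exists_epi_over_iff]
  constructor
  · rintro ⟨I, _, s, hs⟩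
    exact ⟨_, Nat.succ_pos _, _, hs.option.comp_equiv (optionEquiv I)⟩
  · rintro ⟨n, _, s, hs⟩
    exact ⟨_, inferInstance, s, hs⟩

lemma exists_finRel_iff :
    (∃ (I : Type u) (_ : Fintype I) (s : I → Sec M U), IsGen M s ∧ FinRel M s) ↔
      ∃ m n : ℕ, 0 < m ∧ 0 < n ∧
        ∃ (f : (SheafOfModules.free (ULift.{u} (Fin m)) : SheafOfModules.{u} (R.over U)) ⟶
            SheafOfModules.free (ULift.{u} (Fin n)))
          (p : SheafOfModules.free (ULift.{u} (Fin n)) ⟶ M.over U)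
          (w : f ≫ p = 0), Epi p ∧ (ShortComplex.mk f p w).Exact := by
  simp_rw [exists_presentation_over_iff]
  constructor
  · rintro ⟨I, _, s, hs, K, _, r, hr⟩
    exact ⟨_, _, Nat.succ_pos _, Nat.succ_pos _, _, _, hs.option.comp_equiv (optionEquiv I),
      hr.option.comp_equiv (optionEquiv I) (optionEquiv K)⟩
  · rintro ⟨m, n, _, _, s, r, hs, hr⟩
    exact ⟨_, inferInstance, s, hs, _, inferInstance, r, hr⟩

end Padding

section Image

lemma finRel_app_iff {M N : SheafOfModules.{u} R} (f : M ⟶ N) [Mono f] {U : C} {I : Type u}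
    [Fintype I] (s : I → Sec M U) : FinRel N (fun i => app f U (s i)) ↔ FinRel M s := by
  simp_rw [FinRel, isRel_app_iff]

lemma finRel_over_iff (M : SheafOfModules.{u} R) {U : C} (Y : Over U) {I : Type u} [Fintype I]
    (s : I → Sec M Y.left) : FinRel (M.over U) (U := Y) s ↔ FinRel M s :=
  exists_congr fun _ => exists_congr fun _ => exists_congr fun r => isRel_over_iff M Y s r

lemma FinRel.locally_of_isGen {M : SheafOfModules.{u} R} {U : C} {I L : Type u} [Fintype I]
    [Fintype L] {s : I → Sec M U} {e : L → Sec M U} (he : FinRel M e) (hs : IsGen M s)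
    (he' : IsGen M e) : Locally J fun V (g : V ⟶ U) =>
      FinRel M fun i => CoherentSheaves.res M g (s i) := by
  have h₁ := Locally.forall_of_fintype fun i => he' (𝟙 U) (s i)
  have h₂ := Locally.forall_of_fintype fun l => hs (𝟙 U) (e l)
  refine (h₁.and h₂).mono fun V g ⟨h₁, h₂⟩ => (he.res g).of_generated ?_ ?_
  · simpa using h₁
  · simpa using h₂

/-- Finitely many sections over `U` generate a subsheaf of modules of the restriction to `U`. -/
lemma exists_mono_isGen (M : SheafOfModules.{u} R) {T : C} (hT : IsTerminal T) {I : Type u}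
    [Fintype I] (s : I → Sec M T) :
    ∃ (N : SheafOfModules.{u} R) (ι : N ⟶ M) (s' : I → Sec N T),
      Mono ι ∧ IsGen N s' ∧ ∀ i, app ι T (s' i) = s i := by
  refine ⟨_, image.ι (freeDesc hT s), _, inferInstance,
    (epi_iff_isGen hT (factorThruImage (freeDesc hT s))).1 inferInstance, fun i => ?_⟩
  rw [← app_comp, image.fac, app_freeDesc_basisSec_self]

lemma locally_finRel_of_mono_over (M : SheafOfModules.{u} R) {U : C}
    {N : SheafOfModules.{u} (R.over U)} (ι : N ⟶ M.over U) [Mono ι] {I : Type u} [Fintype I]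
    (s : I → Sec M U) (s' : I → Sec N (Over.mk (𝟙 U))) (hs' : IsGen N s')
    (hι : ∀ i, app ι (Over.mk (𝟙 U)) (s' i) = s i) {V : C} (g : V ⟶ U) {L : Type u} [Fintype L]
    (e : L → Sec N (Over.mk g)) (he : IsGen N e) (he' : FinRel N e) :
    Locally J fun V' (h : V' ⟶ V) => FinRel M fun i => res M (h ≫ g) (s i) := by
  let p : Over.mk g ⟶ Over.mk (𝟙 U) := Over.homMk g
  refine (locally_over_iff (Y := Over.mk g) _).1 ((he'.locally_of_isGen (hs'.res p) he).mono
    fun Z h hh => ?_)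
  have h₁ := (finRel_app_iff ι _).2 hh
  have h₂ : (fun i => app ι Z (res N h (res N p (s' i)))) =
      fun i => res (M.over U) (h ≫ p) (s i) := by
    ext i
    rw [app_res, app_res, hι]
    exact res_res (M.over U) p h (s i)
  rw [h₂] at h₁
  exact (finRel_over_iff M Z _).1 h₁

end Image

end Site

variable {X : TopCat.{u}} {R : Sheaf (Opens.grothendieckTopology X) RingCat.{u}}

lemma Locally.of_forall_mem {U : Opens X} {P : ∀ ⦃V : Opens X⦄, (V ⟶ U) → Prop}
    (h : ∀ x ∈ U, ∃ (V : Opens X) (g : V ⟶ U), x ∈ V ∧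
      Locally (Opens.grothendieckTopology X) fun V' (g' : V' ⟶ V) => P (g' ≫ g)) :
    Locally (Opens.grothendieckTopology X) P := by
  let S : Sieve U :=
    { arrows V g := Locally (Opens.grothendieckTopology X) fun V' (g' : V' ⟶ V) => P (g' ≫ g)
      downward_closed hg f := by simpa using hg.pullback f }
  have hS : Locally (Opens.grothendieckTopology X) fun V (g : V ⟶ U) => S g :=
    ⟨S, fun x hx => let ⟨V, g, hV, hg⟩ := h x hx; ⟨V, g, hg, hV⟩, fun _ _ hg => hg⟩
  exact hS.bind fun V g hg => hg

lemma Locally.exists_mem {U : Opens X} {P : ∀ ⦃V : Opens X⦄, (V ⟶ U) → Prop}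
    (h : Locally (Opens.grothendieckTopology X) P) {x : X} (hx : x ∈ U) :
    ∃ (V : Opens X) (g : V ⟶ U), x ∈ V ∧ P g := by
  obtain ⟨S, hS, H⟩ := h
  obtain ⟨V, g, hg, hV⟩ := hS x hx
  exact ⟨V, g, hV, H g hg⟩

lemma isLFG_iff (M : SheafOfModules.{u} R) : IsLFG M ↔ LocallyFinGen M := by
  simp_rw [IsLFG, ← finGen_iff]
  constructor
  · refine fun H U => Locally.of_forall_mem fun x hx => ?_
    obtain ⟨V, hV, h⟩ := H x
    exact ⟨U ⊓ V, homOfLE inf_le_left, ⟨hx, hV⟩,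
      Locally.of_forall fun V' g => h.res (g ≫ homOfLE inf_le_right)⟩
  · intro H x
    obtain ⟨V, -, hV, h⟩ := (H ⊤).exists_mem (Opens.mem_top x)
    exact ⟨V, hV, h⟩

lemma isLFGOver_iff {U : Opens X} (N : SheafOfModules.{u} (R.over U)) :
    IsLFGOver N ↔ ∀ x ∈ U, ∃ (V : Opens X) (h : V ≤ U), x ∈ V ∧
      FinGen N (Over.mk (homOfLE h)) := by
  simp_rw [finGen_iff]
  rfl

lemma isLFPOver_iff {U : Opens X} (N : SheafOfModules.{u} (R.over U)) :
    IsLFPOver N ↔ ∀ x ∈ U, ∃ (V : Opens X) (h : V ≤ U), x ∈ V ∧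
      ∃ (I : Type u) (_ : Fintype I) (s : I → Sec N (Over.mk (homOfLE h))),
        IsGen N s ∧ FinRel N s := by
  simp_rw [exists_finRel_iff]
  rfl

lemma isPseudoCoherent_iff (M : SheafOfModules.{u} R) : IsPseudoCoherent M ↔ LocallyFinRel M := by
  simp_rw [IsPseudoCoherent, isLFGOver_iff, isLFPOver_iff]
  constructor
  · intro H U I _ s
    obtain ⟨N, ι, s', hι, hs', h⟩ := exists_mono_isGen (M.over U) Over.mkIdTerminal s
    refine Locally.of_forall_mem fun x hx => ?_
    obtain ⟨V, hVU, hV, L, _, e, he, he'⟩ := H U N ι hι (fun x hx => ⟨U, le_rfl, hx,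
      I, inferInstance, s', hs'⟩) x hx
    exact ⟨V, homOfLE hVU, hV, locally_finRel_of_mono_over M ι s s' hs' h _ e he he'⟩
  · intro H U N ι _ hN x hx
    obtain ⟨V, hVU, hV, I, _, s, hs⟩ := hN x hx
    obtain ⟨V', g, hV', h⟩ := (H V I fun i => app ι (Over.mk (homOfLE hVU)) (s i)).exists_mem hV
    let p : Over.mk (homOfLE (g.le.trans hVU)) ⟶ Over.mk (homOfLE hVU) := Over.homMk g
    refine ⟨V', g.le.trans hVU, hV', I, inferInstance, _, hs.res p, ?_⟩
    rw [← finRel_app_iff ι]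
    simp_rw [app_res]
    exact (finRel_over_iff M (Over.mk (homOfLE (g.le.trans hVU))) _).2 h

lemma isCoherent_iff (M : SheafOfModules.{u} R) :
    IsCoherent M ↔ LocallyFinGen M ∧ LocallyFinRel M := by
  rw [IsCoherent, isLFG_iff, isPseudoCoherent_iff]

open CategoryTheory.Limits in
/-- Coherent sheaves of modules form an abelian subcategory: they are closed under finite
direct sums, kernels and cokernels. -/
theorem coherent_abelian_subcategory (R' : Sheaf (Opens.grothendieckTopology X) RingCat.{u}) :
    (∀ M N : SheafOfModules.{u} R', IsCoherent M → IsCoherent N → IsCoherent (M ⊞ N)) ∧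
    (∀ (M N : SheafOfModules.{u} R') (φ : M ⟶ N), IsCoherent M → IsCoherent N →
      IsCoherent (kernel φ) ∧ IsCoherent (cokernel φ)) := by
  simp_rw [isCoherent_iff]
  exact ⟨fun M N hM hN => ⟨hM.1.biprod hN.1, hM.2.biprod hN.2⟩, fun M N φ hM hN =>
    ⟨⟨hM.1.kernel φ hN.2, hM.2.of_mono (kernel.ι φ)⟩, ⟨hN.1.cokernel φ, hN.2.cokernel φ hM.1⟩⟩⟩

end CoherentSheaves
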